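/- Let Ω ⊆ {1,…,n₁}×{1,…,n₂}, let T, P_T be associated with orthonormal-column matrices U ∈ ℝ^{n₁×r}, V ∈ ℝ^{n₂×r}, and let p ∈ (0, 1]. If ‖P_T P_Ω P_T − p P_T‖ ≤ p/2 (operator norm with respect to the Frobenius norm), then for every n₁×n₂ matrix X: ‖P_Ω(P_T(X))‖_F ≤ √(3p/2) · ‖P_T(X)‖_F. -/

import Mathlib

open Matrix BigOperators

attribute [local instance] Classical.propDecidable

noncomputable def nuclearNorm {m n : ℕ} (M : Matrix (Fin m) (Fin n) ℝ) : ℝ :=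
  ∑ i, Real.sqrt ((Matrix.isHermitian_conjTranspose_mul_self M).eigenvalues i)

noncomputable def frobNorm {m n : ℕ} (M : Matrix (Fin m) (Fin n) ℝ) : ℝ :=
  Real.sqrt (∑ i, ∑ j, (M i j) ^ 2)

noncomputable def l1Norm {m n : ℕ} (M : Matrix (Fin m) (Fin n) ℝ) : ℝ :=
  ∑ i, ∑ j, |M i j|

noncomputable def supNorm {m n : ℕ} (M : Matrix (Fin m) (Fin n) ℝ) : ℝ :=
  ⨆ p : Fin m × Fin n, |M p.1 p.2|

noncomputable def specNorm {m n : ℕ} (M : Matrix (Fin m) (Fin n) ℝ) : ℝ :=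
  ⨆ i, Real.sqrt ((Matrix.isHermitian_conjTranspose_mul_self M).eigenvalues i)

noncomputable def PΩ {m n : ℕ} (Ω : Finset (Fin m × Fin n)) (M : Matrix (Fin m) (Fin n) ℝ) :
    Matrix (Fin m) (Fin n) ℝ :=
  fun i j => if (i, j) ∈ Ω then M i j else 0

noncomputable def PΩc {m n : ℕ} (Ω : Finset (Fin m × Fin n)) (M : Matrix (Fin m) (Fin n) ℝ) :
    Matrix (Fin m) (Fin n) ℝ :=
  M - PΩ Ω M

noncomputable def PT {m n r : ℕ} (U : Matrix (Fin m) (Fin r) ℝ) (V : Matrix (Fin n) (Fin r) ℝ)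
    (M : Matrix (Fin m) (Fin n) ℝ) : Matrix (Fin m) (Fin n) ℝ :=
  U * Uᵀ * M + M * (V * Vᵀ) - U * Uᵀ * M * (V * Vᵀ)

noncomputable def PTperp {m n r : ℕ} (U : Matrix (Fin m) (Fin r) ℝ) (V : Matrix (Fin n) (Fin r) ℝ)
    (M : Matrix (Fin m) (Fin n) ℝ) : Matrix (Fin m) (Fin n) ℝ :=
  (1 - U * Uᵀ) * M * (1 - V * Vᵀ)

noncomputable def opNorm {m n : ℕ}
    (L : Matrix (Fin m) (Fin n) ℝ → Matrix (Fin m) (Fin n) ℝ) : ℝ :=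
  ⨆ X : {X : Matrix (Fin m) (Fin n) ℝ // frobNorm X ≤ 1}, frobNorm (L X.1)

noncomputable def sgn {m n : ℕ} (S : Matrix (Fin m) (Fin n) ℝ) : Matrix (Fin m) (Fin n) ℝ :=
  fun i j => Real.sign (S i j)

def IsReducedSVD {m n r : ℕ} (X : Matrix (Fin m) (Fin n) ℝ) (U : Matrix (Fin m) (Fin r) ℝ)
    (S : Matrix (Fin r) (Fin r) ℝ) (V : Matrix (Fin n) (Fin r) ℝ) : Prop :=
  Uᵀ * U = 1 ∧ Vᵀ * V = 1 ∧ S.IsDiag ∧ (∀ i, 0 < S i i) ∧ X = U * S * Vᵀ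

def IncoherentUV {m n r : ℕ} (U : Matrix (Fin m) (Fin r) ℝ) (V : Matrix (Fin n) (Fin r) ℝ)
    (μ : ℝ) : Prop :=
  (∀ k, ∑ i, (U k i) ^ 2 ≤ μ * (r : ℝ) / (m : ℝ)) ∧
  (∀ k, ∑ i, (V k i) ^ 2 ≤ μ * (r : ℝ) / (n : ℝ)) ∧
  ∀ i j, |(U * Vᵀ) i j| ≤ Real.sqrt (μ * (r : ℝ) / ((m : ℝ) * (n : ℝ)))

def HasIncoherentSVD {m n : ℕ} (X : Matrix (Fin m) (Fin n) ℝ) (r : ℕ) (μ : ℝ) : Prop :=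
  ∃ (U : Matrix (Fin m) (Fin r) ℝ) (S : Matrix (Fin r) (Fin r) ℝ) (V : Matrix (Fin n) (Fin r) ℝ),
    IsReducedSVD X U S V ∧ IncoherentUV U V μ

def UniqueRPCAMin {n₁ n₂ : ℕ} (A : Matrix (Fin n₁) (Fin n₁) ℝ) (lam : ℝ)
    (M X₀ S₀ : Matrix (Fin n₁) (Fin n₂) ℝ) : Prop :=
  X₀ + S₀ = M ∧ ∀ X S : Matrix (Fin n₁) (Fin n₂) ℝ, X + S = M → (X, S) ≠ (X₀, S₀) →
    nuclearNorm (A * X₀) + lam * l1Norm S₀ < nuclearNorm (A * X) + lam * l1Norm S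

def memT {n₁ n₂ r : ℕ} (U : Matrix (Fin n₁) (Fin r) ℝ) (V : Matrix (Fin n₂) (Fin r) ℝ)
    (M : Matrix (Fin n₁) (Fin n₂) ℝ) : Prop :=
  ∃ (X : Matrix (Fin n₂) (Fin r) ℝ) (Y : Matrix (Fin n₁) (Fin r) ℝ), M = U * Xᵀ + Y * Vᵀ

noncomputable def berProb (n₁ n₂ : ℕ) (p : ℝ) (E : Finset (Fin n₁ × Fin n₂) → Prop) : ℝ :=
  ∑ Ω : Finset (Fin n₁ × Fin n₂),
    (if E Ω then (1 : ℝ) else 0) * p ^ Ω.card * (1 - p) ^ (n₁ * n₂ - Ω.card)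

/-- The linear map underlying `PΩ`. -/
noncomputable def PΩLin {m n : ℕ} (Ω : Finset (Fin m × Fin n)) :
    Matrix (Fin m) (Fin n) ℝ →ₗ[ℝ] Matrix (Fin m) (Fin n) ℝ where
  toFun := PΩ Ω
  map_add' A B := by
    ext i j
    by_cases hij : (i, j) ∈ Ω <;> simp [PΩ, hij]
  map_smul' c A := by
    ext i j
    by_cases hij : (i, j) ∈ Ω <;> simp [PΩ, hij]

/-- The linear map underlying `PT`. -/
noncomputable def PTLin {m n r : ℕ} (U : Matrix (Fin m) (Fin r) ℝ)
    (V : Matrix (Fin n) (Fin r) ℝ) :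
    Matrix (Fin m) (Fin n) ℝ →ₗ[ℝ] Matrix (Fin m) (Fin n) ℝ where
  toFun := PT U V
  map_add' A B := by
    simp only [PT, Matrix.mul_add, Matrix.add_mul]
    abel
  map_smul' c A := by
    simp [PT, smul_add, smul_sub]

theorem frobNorm_nonneg {m n : ℕ} (M : Matrix (Fin m) (Fin n) ℝ) : 0 ≤ frobNorm M :=
  Real.sqrt_nonneg _

theorem frobNorm_sq {m n : ℕ} (M : Matrix (Fin m) (Fin n) ℝ) :
    frobNorm M ^ 2 = (Mᵀ * M).trace := by
  rw [frobNorm, Real.sq_sqrt (by positivity), Finset.sum_comm]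
  simp [Matrix.trace, Matrix.mul_apply, sq]

theorem trace_transpose_mul_le {m n : ℕ} (A B : Matrix (Fin m) (Fin n) ℝ) :
    (Aᵀ * B).trace ≤ frobNorm A * frobNorm B := by
  have key := Real.sum_mul_le_sqrt_mul_sqrt (Finset.univ : Finset (Fin m × Fin n))
    (fun q => A q.1 q.2) (fun q => B q.1 q.2)
  simp only [Fintype.sum_prod_type] at key
  rw [Finset.sum_comm] at key
  simpa [Matrix.trace, Matrix.mul_apply, frobNorm] using key

theorem LinearMap.exists_norm_le_of_norm_le_one {E F : Type*} [NormedAddCommGroup E]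
    [NormedSpace ℝ E] [FiniteDimensional ℝ E] [NormedAddCommGroup F] [NormedSpace ℝ F]
    (L : E →ₗ[ℝ] F) : ∃ C : ℝ, ∀ x, ‖x‖ ≤ 1 → ‖L x‖ ≤ C :=
  ⟨‖L.toContinuousLinearMap‖, fun x hx => L.toContinuousLinearMap.unit_le_opNorm x hx⟩

section Norm

attribute [local instance] Matrix.frobeniusNormedAddCommGroup Matrix.frobeniusNormedSpace

theorem frobNorm_eq_norm {m n : ℕ} (M : Matrix (Fin m) (Fin n) ℝ) : frobNorm M = ‖M‖ := by
  simp [frobNorm, Matrix.frobenius_norm_def, Real.sqrt_eq_rpow]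

theorem frobNorm_map_le_opNorm {m n : ℕ}
    (L : Matrix (Fin m) (Fin n) ℝ →ₗ[ℝ] Matrix (Fin m) (Fin n) ℝ)
    (X : Matrix (Fin m) (Fin n) ℝ) :
    frobNorm (L X) ≤ opNorm L * frobNorm X := by
  have hbdd : BddAbove (Set.range fun Y : {Y : Matrix (Fin m) (Fin n) ℝ // frobNorm Y ≤ 1} =>
      frobNorm (L Y.1)) := by
    obtain ⟨C, hC⟩ := L.exists_norm_le_of_norm_le_one
    refine ⟨C, ?_⟩
    rintro _ ⟨⟨Y, hY⟩, rfl⟩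
    simpa only [frobNorm_eq_norm] using hC Y (frobNorm_eq_norm Y ▸ hY)
  rcases eq_or_ne X 0 with rfl | hX
  · simp [frobNorm]
  have hpos : 0 < ‖X‖ := norm_pos_iff.mpr hX
  have hunit : frobNorm (‖X‖⁻¹ • X) ≤ 1 := by
    rw [frobNorm_eq_norm, norm_smul, norm_inv, norm_norm, inv_mul_cancel₀ hpos.ne']
  have hle : frobNorm (L (‖X‖⁻¹ • X)) ≤ opNorm L := le_ciSup hbdd ⟨_, hunit⟩
  rw [map_smul, frobNorm_eq_norm, norm_smul, norm_inv, norm_norm, inv_mul_le_iff₀ hpos] at hle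
  rw [frobNorm_eq_norm, frobNorm_eq_norm, mul_comm]
  exact hle

end Norm

theorem trace_transpose_PΩ_mul_self {m n : ℕ} (Ω : Finset (Fin m × Fin n))
    (M : Matrix (Fin m) (Fin n) ℝ) :
    ((PΩ Ω M)ᵀ * PΩ Ω M).trace = (Mᵀ * PΩ Ω M).trace := by
  simp only [Matrix.trace, Matrix.diag_apply, Matrix.mul_apply, Matrix.transpose_apply, PΩ]
  refine Finset.sum_congr rfl fun j _ => Finset.sum_congr rfl fun i _ => ?_
  split_ifs <;> simp

theorem trace_transpose_PT_mul {m n r : ℕ} (U : Matrix (Fin m) (Fin r) ℝ)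
    (V : Matrix (Fin n) (Fin r) ℝ) (A B : Matrix (Fin m) (Fin n) ℝ) :
    ((PT U V A)ᵀ * B).trace = (Aᵀ * PT U V B).trace := by
  have hcycle (C : Matrix (Fin n) (Fin n) ℝ) :
      (V * Vᵀ * C).trace = (C * (V * Vᵀ)).trace := Matrix.trace_mul_comm _ _
  simp only [PT, transpose_sub, transpose_add, transpose_mul, transpose_transpose,
    Matrix.add_mul, Matrix.sub_mul, Matrix.mul_add, Matrix.mul_sub, trace_add, trace_sub]
  rw [Matrix.mul_assoc (V * Vᵀ) Aᵀ B, hcycle, Matrix.mul_assoc (V * Vᵀ), hcycle]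
  simp only [Matrix.mul_assoc]

theorem PT_PT {m n r : ℕ} {U : Matrix (Fin m) (Fin r) ℝ} {V : Matrix (Fin n) (Fin r) ℝ}
    (hU : Uᵀ * U = 1) (hV : Vᵀ * V = 1) (M : Matrix (Fin m) (Fin n) ℝ) :
    PT U V (PT U V M) = PT U V M := by
  have hUU (k : ℕ) (C : Matrix (Fin r) (Fin k) ℝ) : Uᵀ * (U * C) = C := by
    rw [← Matrix.mul_assoc, hU, Matrix.one_mul]
  have hVV (k : ℕ) (C : Matrix (Fin r) (Fin k) ℝ) : Vᵀ * (V * C) = C := by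
    rw [← Matrix.mul_assoc, hV, Matrix.one_mul]
  simp only [PT, Matrix.add_mul, Matrix.sub_mul, Matrix.mul_add, Matrix.mul_sub,
    Matrix.mul_assoc, hUU, hVV]
  abel

theorem pOmega_pT_bound {n₁ n₂ r : ℕ} (Ω : Finset (Fin n₁ × Fin n₂))
    (U : Matrix (Fin n₁) (Fin r) ℝ) (V : Matrix (Fin n₂) (Fin r) ℝ)
    (hU : Uᵀ * U = 1) (hV : Vᵀ * V = 1) (p : ℝ) (hp0 : 0 < p) (hp1 : p ≤ 1)
    (h : opNorm (fun X => PT U V (PΩ Ω (PT U V X)) - p • PT U V X) ≤ p / 2) :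
    ∀ X : Matrix (Fin n₁) (Fin n₂) ℝ,
      frobNorm (PΩ Ω (PT U V X)) ≤ Real.sqrt (3 * p / 2) * frobNorm (PT U V X) := by
  intro X
  have hidem := PT_PT hU hV X
  set Y := PT U V X
  have hL : frobNorm (PT U V (PΩ Ω Y) - p • Y) ≤ p / 2 * frobNorm Y := by
    have hmap := frobNorm_map_le_opNorm
      (PTLin U V ∘ₗ PΩLin Ω ∘ₗ PTLin U V - p • PTLin U V) Y
    have hY : frobNorm (PT U V (PΩ Ω (PT U V Y)) - p • PT U V Y) ≤ p / 2 * frobNorm Y :=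
      hmap.trans (mul_le_mul_of_nonneg_right h (frobNorm_nonneg Y))
    rwa [hidem] at hY
  have hsq : frobNorm (PΩ Ω Y) ^ 2 ≤ 3 * p / 2 * frobNorm Y ^ 2 := by
    calc frobNorm (PΩ Ω Y) ^ 2 = (Yᵀ * PT U V (PΩ Ω Y)).trace := by
          rw [frobNorm_sq, trace_transpose_PΩ_mul_self, ← trace_transpose_PT_mul, hidem]
      _ = (Yᵀ * (PT U V (PΩ Ω Y) - p • Y)).trace + p * frobNorm Y ^ 2 := by
          simp [Matrix.mul_sub, frobNorm_sq]
      _ ≤ frobNorm Y * (p / 2 * frobNorm Y) + p * frobNorm Y ^ 2 := by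
          gcongr
          exact (trace_transpose_mul_le _ _).trans
            (mul_le_mul_of_nonneg_left hL (frobNorm_nonneg Y))
      _ = 3 * p / 2 * frobNorm Y ^ 2 := by ring
  rw [← Real.sqrt_sq (frobNorm_nonneg Y), ← Real.sqrt_mul (by positivity)]
  exact Real.le_sqrt_of_sq_le hsq
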